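/- There exists an absolute constant c > 0 such that for every finite set A ⊆ ℝ with 0 ∈ A and |A| ≥ 2, one has |A² + A²| · max{ |A − A + A|, |A + A + A| }⁴ · log|A| ≥ c·|A|⁶, where A² = {a² : a ∈ A}, A − A + A = {a − b + c : a, b, c ∈ A}, and A + A + A = {a + b + c : a, b, c ∈ A}. -/

import Mathlib

open Finset Pointwise

/-- points on the half line of slope `l` -/
noncomputable def hline (X : Finset ℝ) (l : ℝ) : Finset ℝ :=
  X.filter (fun y => 0 < y ∧ l * y ∈ X)

/-- points on the full line of slope `l`, without the origin -/
noncomputable def fline (X : Finset ℝ) (l : ℝ) : Finset ℝ :=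
  X.filter (fun y => y ≠ 0 ∧ l * y ∈ X)

lemma sector_induct (X : Finset ℝ) (t : ℕ) (L : Finset ℝ) :
    (∀ l ∈ L, t ≤ (hline X l).card) → ∀ M ∈ L, (∀ l ∈ L, l ≤ M) →
    L.card * t ^ 2 ≤ (((X + X) ×ˢ (X + X)).filter
      (fun p => 0 < p.1 ∧ p.2 < M * p.1)).card + t ^ 2 := by
  induction L using Finset.induction_on_max with
  | empty => intro _ M hM; simp at hM
  | insert m L hm ih =>
    intro ht M hM hub
    have hMm : M = m := by
      rcases Finset.mem_insert.1 hM with h | h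
      · exact h
      · exact absurd (hub m (Finset.mem_insert_self _ _)) (not_le.2 (hm M h))
    subst hMm
    have hnot : M ∉ L := fun h => lt_irrefl _ (hm M h)
    rw [Finset.card_insert_of_notMem hnot]
    rcases L.eq_empty_or_nonempty with rfl | hne
    · simp
    have hm0 := L.max'_mem hne
    set m0 := L.max' hne with hm0def
    have ih' := ih (fun l hl => ht l (Finset.mem_insert_of_mem hl)) m0 hm0
      (fun l hl => L.le_max' l hl)
    have hlt : m0 < M := hm m0 hm0
    set F0 := ((X + X) ×ˢ (X + X)).filter (fun p : ℝ × ℝ => 0 < p.1 ∧ p.2 < m0 * p.1)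
    set F1 := ((X + X) ×ˢ (X + X)).filter (fun p : ℝ × ℝ => 0 < p.1 ∧ p.2 < M * p.1)
    set T := ((hline X m0) ×ˢ (hline X M)).image
      (fun p : ℝ × ℝ => (p.1 + p.2, m0 * p.1 + M * p.2)) with hT
    have hTcard : t ^ 2 ≤ T.card := by
      rw [hT, Finset.card_image_of_injective, Finset.card_product, sq]
      · exact Nat.mul_le_mul (ht _ (Finset.mem_insert_of_mem hm0))
          (ht _ (Finset.mem_insert_self _ _))
      · rintro ⟨a, b⟩ ⟨c, d⟩ h
        simp only [Prod.mk.injEq] at h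
        obtain ⟨h1, h2⟩ := h
        have : (M - m0) * (b - d) = 0 := by
          have : a = c + d - b := by linarith
          subst this
          linarith
        have hb : b = d := by
          rcases mul_eq_zero.1 this with h | h <;> linarith
        subst hb
        simp only [Prod.mk.injEq, and_true]
        linarith
    have hdisj : Disjoint F0 T := by
      rw [Finset.disjoint_left]
      rintro ⟨u, v⟩ h0 h1
      simp only [F0, Finset.mem_filter] at h0
      simp only [hT, hline, Finset.mem_image, Finset.mem_product, Finset.mem_filter,
        Prod.mk.injEq, Prod.exists] at h1
      obtain ⟨a, b, ⟨⟨_, ha, _⟩, ⟨_, hb, _⟩⟩, rfl, rfl⟩ := h1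
      have := h0.2.2
      nlinarith [mul_pos (sub_pos.2 hlt) hb]
    have hsub : F0 ∪ T ⊆ F1 := by
      intro p hp
      rcases Finset.mem_union.1 hp with hp | hp
      · simp only [F0, Finset.mem_filter] at hp
        simp only [F1, Finset.mem_filter]
        exact ⟨hp.1, hp.2.1, by nlinarith [hp.2.1, hp.2.2]⟩
      · obtain ⟨u, v⟩ := p
        simp only [hT, hline, Finset.mem_image, Finset.mem_product, Finset.mem_filter,
          Prod.mk.injEq, Prod.exists] at hp
        obtain ⟨a, b, ⟨⟨ha1, ha, ha2⟩, ⟨hb1, hb, hb2⟩⟩, rfl, rfl⟩ := hp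
        simp only [F1, Finset.mem_filter, Finset.mem_product]
        exact ⟨⟨Finset.add_mem_add ha1 hb1, Finset.add_mem_add ha2 hb2⟩, by linarith,
          by nlinarith [mul_pos (sub_pos.2 hlt) ha]⟩
    have hc := Finset.card_le_card hsub
    rw [Finset.card_union_of_disjoint hdisj] at hc
    have : (L.card + 1) * t ^ 2 = L.card * t ^ 2 + t ^ 2 := by ring
    omega

lemma card_le_card_add (X : Finset ℝ) : X.card ≤ (X + X).card := by
  rcases X.eq_empty_or_nonempty with rfl | h
  · simp
  · exact Finset.card_le_card_add_right h

lemma rich_lines (X : Finset ℝ) (t : ℕ) (L : Finset ℝ)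
    (h : ∀ l ∈ L, t ≤ (hline X l).card) : L.card * t ^ 2 ≤ 2 * (X + X).card ^ 2 := by
  rcases L.eq_empty_or_nonempty with rfl | hne
  · simp
  have h1 := sector_induct X t L h _ (L.max'_mem hne) (fun l hl => L.le_max' l hl)
  have h2 : t ≤ (X + X).card :=
    (h _ (L.max'_mem hne)).trans ((Finset.card_filter_le _ _).trans (card_le_card_add X))
  have h3 := Nat.pow_le_pow_left h2 2
  have h4 := Finset.card_filter_le ((X + X) ×ˢ (X + X))
    (fun p : ℝ × ℝ => 0 < p.1 ∧ p.2 < L.max' hne * p.1)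
  rw [Finset.card_product, ← sq] at h4
  omega

lemma half_energy (X Λ : Finset ℝ) :
    ∑ l ∈ Λ, ((hline X l).card : ℝ) ^ 2 ≤
      4 * ((X + X).card : ℝ) ^ 2 * (harmonic X.card : ℝ) := by
  have key : ∀ r n : ℕ, r ≤ n →
      (r : ℝ) ^ 2 ≤ ∑ t ∈ Finset.range n, if t + 1 ≤ r then 2 * ((t : ℝ) + 1) else 0 := by
    intro r n hrn
    rw [← Finset.sum_filter]
    have : (Finset.range n).filter (fun t => t + 1 ≤ r) = Finset.range r := by
      ext t; simp only [Finset.mem_filter, Finset.mem_range]; omega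
    rw [this]
    clear this hrn
    induction r with
    | zero => simp
    | succ r ih =>
      rw [Finset.sum_range_succ]; push_cast; nlinarith
  calc ∑ l ∈ Λ, ((hline X l).card : ℝ) ^ 2
      ≤ ∑ l ∈ Λ, ∑ t ∈ Finset.range X.card,
          if t + 1 ≤ (hline X l).card then 2 * ((t : ℝ) + 1) else 0 :=
        Finset.sum_le_sum fun l _ => key _ _ (Finset.card_filter_le _ _)
    _ = ∑ t ∈ Finset.range X.card, ∑ l ∈ Λ,
          if t + 1 ≤ (hline X l).card then 2 * ((t : ℝ) + 1) else 0 := Finset.sum_comm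
    _ ≤ ∑ t ∈ Finset.range X.card, 4 * ((X + X).card : ℝ) ^ 2 * ((t : ℝ) + 1)⁻¹ := by
        refine Finset.sum_le_sum fun t _ => ?_
        rw [← Finset.sum_filter, Finset.sum_const, nsmul_eq_mul]
        have h := rich_lines X (t + 1) (Λ.filter fun l => t + 1 ≤ (hline X l).card)
          (fun l hl => (Finset.mem_filter.1 hl).2)
        have h' : ((Λ.filter fun l => t + 1 ≤ (hline X l).card).card : ℝ) * ((t : ℝ) + 1) ^ 2
            ≤ 2 * ((X + X).card : ℝ) ^ 2 := by exact_mod_cast h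
        have hp : (0 : ℝ) < (t : ℝ) + 1 := by positivity
        rw [← div_eq_mul_inv, le_div_iff₀ hp]
        nlinarith
    _ = _ := by
        rw [← Finset.mul_sum]
        simp [harmonic]

lemma fline_card (X : Finset ℝ) (l : ℝ) :
    (fline X l).card ≤ (hline X l).card + (hline (-X) l).card := by
  have : fline X l ⊆ hline X l ∪ (hline (-X) l).image (fun y => -y) := by
    intro y hy
    simp only [fline, Finset.mem_filter] at hy
    obtain ⟨h1, h2, h3⟩ := hy
    rcases lt_or_gt_of_ne h2 with h | h
    · apply Finset.mem_union_right
      simp only [hline, Finset.mem_image, Finset.mem_filter]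
      refine ⟨-y, ⟨by simpa using h1, by linarith, by simpa using h3⟩, by ring⟩
    · apply Finset.mem_union_left
      simp only [hline, Finset.mem_filter]
      exact ⟨h1, h, h3⟩
  exact (Finset.card_le_card this).trans ((Finset.card_union_le _ _).trans
    (Nat.add_le_add_left Finset.card_image_le _))

lemma full_energy (X Λ : Finset ℝ) :
    ∑ l ∈ Λ, ((fline X l).card : ℝ) ^ 2 ≤
      16 * ((X + X).card : ℝ) ^ 2 * (harmonic X.card : ℝ) := by
  have h1 := half_energy X Λ
  have h2 := half_energy (-X) Λ
  have e1 : (-X + -X).card = (X + X).card := by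
    rw [← neg_add, Finset.card_neg]
  rw [e1, Finset.card_neg] at h2
  calc ∑ l ∈ Λ, ((fline X l).card : ℝ) ^ 2
      ≤ ∑ l ∈ Λ, (2 * ((hline X l).card : ℝ) ^ 2 + 2 * ((hline (-X) l).card : ℝ) ^ 2) := by
        refine Finset.sum_le_sum fun l _ => ?_
        have h : ((fline X l).card : ℝ) ≤ (hline X l).card + (hline (-X) l).card := by
          exact_mod_cast fline_card X l
        have h0 : (0 : ℝ) ≤ (fline X l).card := by positivity
        nlinarith [sq_nonneg (((hline X l).card : ℝ) - (hline (-X) l).card)]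
    _ = 2 * ∑ l ∈ Λ, ((hline X l).card : ℝ) ^ 2
          + 2 * ∑ l ∈ Λ, ((hline (-X) l).card : ℝ) ^ 2 := by
        rw [Finset.sum_add_distrib, Finset.mul_sum, Finset.mul_sum]
    _ ≤ _ := by linarith

/-- quadruples with `a² + b² = c² + d²` -/
noncomputable def quads (A : Finset ℝ) : Finset ((ℝ × ℝ) × (ℝ × ℝ)) :=
  ((A ×ˢ A) ×ˢ (A ×ˢ A)).filter
    (fun q => q.1.1 ^ 2 + q.1.2 ^ 2 = q.2.1 ^ 2 + q.2.2 ^ 2)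

lemma quads_lower (A : Finset ℝ) :
    (A.card : ℝ) ^ 4 ≤
      ((A.image (fun a => a ^ 2) + A.image (fun a => a ^ 2)).card : ℝ) * (quads A).card := by
  set S := A.image (fun a => a ^ 2) + A.image (fun a => a ^ 2) with hS
  set f : ℝ × ℝ → ℝ := fun p => p.1 ^ 2 + p.2 ^ 2 with hf
  have hmaps : ∀ p ∈ A ×ˢ A, f p ∈ S := by
    intro p hp
    rw [Finset.mem_product] at hp
    exact Finset.add_mem_add (Finset.mem_image_of_mem _ hp.1) (Finset.mem_image_of_mem _ hp.2)
  have h1 : (A ×ˢ A).card = ∑ s ∈ S, ((A ×ˢ A).filter (fun p => f p = s)).card :=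
    Finset.card_eq_sum_card_fiberwise hmaps
  have h2 : (quads A).card = ∑ s ∈ S, ((A ×ˢ A).filter (fun p => f p = s)).card ^ 2 := by
    have hm : ∀ q ∈ quads A, f q.1 ∈ S := by
      intro q hq
      simp only [quads, Finset.mem_filter, Finset.mem_product] at hq
      exact hmaps _ (Finset.mem_product.2 hq.1.1)
    rw [Finset.card_eq_sum_card_fiberwise hm]
    refine Finset.sum_congr rfl fun s _ => ?_
    rw [sq, ← Finset.card_product]
    congr 1
    ext q
    simp only [quads, hf, Finset.mem_filter, Finset.mem_product]
    constructor
    · rintro ⟨⟨⟨h1, h2⟩, h3⟩, h4⟩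
      exact ⟨⟨h1, h4⟩, h2, h3 ▸ h4⟩
    · rintro ⟨⟨h1, h4⟩, h2, h3⟩
      exact ⟨⟨⟨h1, h2⟩, h4.trans h3.symm⟩, h4⟩
  have h3 := sq_sum_le_card_mul_sum_sq (s := S)
    (f := fun s => (((A ×ˢ A).filter (fun p => f p = s)).card : ℝ))
  have h1' : ((A.card : ℝ)) ^ 2 = ∑ s ∈ S, (((A ×ˢ A).filter (fun p => f p = s)).card : ℝ) := by
    rw [Finset.card_product] at h1
    rw [sq]; exact_mod_cast h1
  have h2' : ((quads A).card : ℝ)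
      = ∑ s ∈ S, (((A ×ˢ A).filter (fun p => f p = s)).card : ℝ) ^ 2 := by
    exact_mod_cast h2
  rw [← h1', ← h2'] at h3
  calc (A.card : ℝ) ^ 4 = ((A.card : ℝ) ^ 2) ^ 2 := by ring
    _ ≤ _ := h3

lemma quads_upper (A : Finset ℝ) : ∃ Λ : Finset ℝ,
    (quads A).card ≤ 3 * A.card ^ 2
      + ∑ l ∈ Λ, (fline (A - A) l).card * (fline (A + A) l).card := by
  set Λ : Finset ℝ := ((A - A) ×ˢ (A - A)).image (fun p => p.1 / p.2) with hΛ
  refine ⟨Λ, ?_⟩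
  set D1 := (A ×ˢ A).image (fun p : ℝ × ℝ => (p, (p.1, p.2)))
  set D2 := (A ×ˢ A).image (fun p : ℝ × ℝ => (p, (-p.1, p.2)))
  set D3 := (A ×ˢ A).image (fun p : ℝ × ℝ => (p, (-p.1, -p.2)))
  set G := (quads A).filter (fun q => q.2.2 - q.1.2 ≠ 0 ∧ q.1.1 + q.2.1 ≠ 0)
  have hsub : quads A ⊆ (D1 ∪ D2 ∪ D3) ∪ G := by
    rintro ⟨⟨a, b⟩, ⟨c, d⟩⟩ hq
    by_cases hg : d - b ≠ 0 ∧ a + c ≠ 0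
    · exact Finset.mem_union_right _ (Finset.mem_filter.2 ⟨hq, hg⟩)
    · apply Finset.mem_union_left
      simp only [quads, Finset.mem_filter, Finset.mem_product] at hq
      obtain ⟨⟨⟨ha, hb⟩, hc, hd⟩, he⟩ := hq
      simp only [D1, D2, D3, Finset.mem_union, Finset.mem_image, Finset.mem_product,
        Prod.mk.injEq, Prod.exists]
      by_cases hdb : d - b = 0
      · have : d = b := by linarith
        subst this
        have : a ^ 2 = c ^ 2 := by linarith
        rcases sq_eq_sq_iff_eq_or_eq_neg.1 this with h | h
        · left; left
          exact ⟨a, d, ⟨ha, hb⟩, ⟨rfl, rfl⟩, h, rfl⟩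
        · left; right
          exact ⟨a, d, ⟨ha, hb⟩, ⟨rfl, rfl⟩, by linarith, rfl⟩
      · have hac : a + c = 0 := by
          by_contra h; exact hg ⟨hdb, h⟩
        have : c = -a := by linarith
        subst this
        have : b ^ 2 = d ^ 2 := by linarith [neg_sq a]
        rcases sq_eq_sq_iff_eq_or_eq_neg.1 this with h | h
        · exact absurd (by linarith) hdb
        · right
          exact ⟨a, b, ⟨ha, hb⟩, ⟨rfl, rfl⟩, rfl, by linarith⟩
  have hG : G.card ≤ ∑ l ∈ Λ, (fline (A - A) l).card * (fline (A + A) l).card := by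
    have : G.card ≤ (Λ.sigma fun l => (fline (A - A) l) ×ˢ (fline (A + A) l)).card := by
      refine Finset.card_le_card_of_injOn
        (fun q => ⟨(q.1.1 - q.2.1) / (q.2.2 - q.1.2), (q.2.2 - q.1.2, q.1.1 + q.2.1)⟩) ?_ ?_
      · rintro ⟨⟨a, b⟩, ⟨c, d⟩⟩ hq
        simp only [G, quads, Finset.coe_filter, Set.mem_ofPred_eq, Finset.mem_filter,
          Finset.mem_product] at hq
        obtain ⟨⟨⟨⟨ha, hb⟩, hc, hd⟩, he⟩, h1, h2⟩ := hq
        simp only [Finset.mem_coe, Finset.mem_sigma, Finset.mem_product, fline,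
          Finset.mem_filter]
        refine ⟨?_, ⟨Finset.sub_mem_sub hd hb, h1, ?_⟩, ⟨Finset.add_mem_add ha hc, h2, ?_⟩⟩
        · exact Finset.mem_image.2 ⟨(a - c, d - b), Finset.mem_product.2
            ⟨Finset.sub_mem_sub ha hc, Finset.sub_mem_sub hd hb⟩, rfl⟩
        · rw [div_mul_cancel₀ _ h1]; exact Finset.sub_mem_sub ha hc
        · have : (a - c) / (d - b) * (a + c) = d + b := by
            field_simp
            linarith
          rw [this]; exact Finset.add_mem_add hd hb
      · rintro ⟨⟨a, b⟩, ⟨c, d⟩⟩ hq ⟨⟨a', b'⟩, ⟨c', d'⟩⟩ hq' heq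
        simp only [G, quads, Finset.coe_filter, Set.mem_ofPred_eq, Finset.mem_filter,
          Finset.mem_product] at hq hq'
        obtain ⟨⟨_, he⟩, h1, h2⟩ := hq
        obtain ⟨⟨_, he'⟩, h1', h2'⟩ := hq'
        simp only [Sigma.mk.injEq, heq_eq_eq, Prod.mk.injEq] at heq
        obtain ⟨e1, e2, e3⟩ := heq
        rw [← e2] at e1
        have e4 : a - c = a' - c' := by
          field_simp at e1
          linarith
        have e5 : d + b = d' + b' := by
          have k1 : (d + b) * (d - b) = (a - c) * (a + c) := by linarith
          have k2 : (d' + b') * (d' - b') = (a' - c') * (a' + c') := by linarith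
          rw [← e2, ← e3, ← e4, ← k1] at k2
          exact (mul_right_cancel₀ h1 k2).symm
        simp only [Prod.mk.injEq]
        refine ⟨⟨?_, ?_⟩, ?_, ?_⟩ <;> linarith
    rw [Finset.card_sigma] at this
    simpa only [Finset.card_product] using this
  have hD : ∀ g : ℝ × ℝ → (ℝ × ℝ) × (ℝ × ℝ), ((A ×ˢ A).image g).card ≤ A.card ^ 2 := by
    intro g
    rw [sq, ← Finset.card_product]
    exact Finset.card_image_le
  have c1 : D1.card ≤ A.card ^ 2 := hD _
  have c2 : D2.card ≤ A.card ^ 2 := hD _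
  have c3 : D3.card ≤ A.card ^ 2 := hD _
  have u0 := Finset.card_le_card hsub
  have u1 := Finset.card_union_le (D1 ∪ D2 ∪ D3) G
  have u2 := Finset.card_union_le (D1 ∪ D2) D3
  have u3 := Finset.card_union_le D1 D2
  omega

lemma harm_bound (n m : ℕ) (hn : 2 ≤ n) (hm : m ≤ n * n) (hm0 : 0 < m) :
    (harmonic m : ℝ) ≤ 4 * Real.log n := by
  have h1 := harmonic_le_one_add_log m
  have h2 : Real.log m ≤ 2 * Real.log n := by
    have : Real.log m ≤ Real.log ((n : ℝ) ^ 2) := by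
      apply Real.log_le_log (by exact_mod_cast hm0)
      rw [sq]; exact_mod_cast hm
    rw [Real.log_pow] at this
    exact_mod_cast this
  have h3 : Real.log 2 ≤ Real.log n := Real.log_le_log (by norm_num) (by exact_mod_cast hn)
  have := Real.log_two_gt_d9
  linarith

theorem stmt19 :
    ∃ c : ℝ, 0 < c ∧
      ∀ A : Finset ℝ, (0 : ℝ) ∈ A → 2 ≤ A.card →
        c * (A.card : ℝ) ^ 6 ≤
          ((A.image (fun a => a ^ 2) + A.image (fun a => a ^ 2)).card : ℝ)
            * (max ((A - A + A).card : ℝ) ((A + A + A).card : ℝ)) ^ 4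
            * Real.log (A.card : ℝ) := by
  refine ⟨1 / 70, by norm_num, ?_⟩
  intro A h0 hA
  have hne : A.Nonempty := ⟨0, h0⟩
  set S : ℝ := max ((A - A + A).card : ℝ) ((A + A + A).card : ℝ) with hS
  set n : ℝ := (A.card : ℝ) with hn
  have hn2 : (2 : ℝ) ≤ n := by rw [hn]; exact_mod_cast hA
  have hS1 : ((A - A + A).card : ℝ) ≤ S := le_max_left _ _
  have hS2 : ((A + A + A).card : ℝ) ≤ S := le_max_right _ _
  have hnS : n ≤ S := by
    refine le_trans ?_ hS2
    have h1 := card_le_card_add A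
    have h2 : (A + A).card ≤ (A + A + A).card := Finset.card_le_card_add_right hne
    rw [hn]; exact_mod_cast h1.trans h2
  have hlog : (1 : ℝ) / 2 ≤ Real.log n := by
    have h3 : Real.log 2 ≤ Real.log n := Real.log_le_log (by norm_num) hn2
    have := Real.log_two_gt_d9
    linarith
  -- sumset bounds
  have hX : ((A - A + (A - A)).card : ℝ) * n ≤ S ^ 2 := by
    have h := Finset.ruzsa_triangle_inequality_sub_add_add (A + A) A (A + A)
    have e : A + A - (A + A) = A - A + (A - A) := add_sub_add_comm _ _ _ _
    rw [e] at h
    have h' : ((A - A + (A - A)).card : ℝ) * n ≤ ((A + A + A).card : ℝ) * (A + A + A).card := by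
      rw [hn]; exact_mod_cast h
    refine h'.trans ?_
    rw [sq]; gcongr
  have hY : ((A + A + (A + A)).card : ℝ) * n ≤ S ^ 2 := by
    have h := Finset.ruzsa_triangle_inequality_add_sub_add (A + A) A (A + A)
    have e : A + A - A = A - A + A := by rw [add_sub_right_comm]
    have e2 : A + (A + A) = A + A + A := by rw [add_assoc]
    have e3 : A - (A + A) = -(A - A + A) := by rw [← e, neg_sub]
    rw [e3, Finset.card_neg, mul_comm] at h
    have h' : ((A + A + (A + A)).card : ℝ) * n ≤ ((A - A + A).card : ℝ) * (A + A + A).card := by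
      rw [hn, ← e2]; exact_mod_cast h
    refine h'.trans ?_
    rw [sq]; gcongr
  obtain ⟨Λ, hQ⟩ := quads_upper A
  have hQ' : ((quads A).card : ℝ) ≤ 3 * n ^ 2
      + ∑ l ∈ Λ, ((fline (A - A) l).card : ℝ) * (fline (A + A) l).card := by
    rw [hn]; exact_mod_cast hQ
  have eX := full_energy (A - A) Λ
  have eY := full_energy (A + A) Λ
  have gX : (harmonic (A - A).card : ℝ) ≤ 4 * Real.log n :=
    harm_bound _ _ hA Finset.card_sub_le (Finset.card_pos.2 (hne.sub hne))
  have gY : (harmonic (A + A).card : ℝ) ≤ 4 * Real.log n :=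
    harm_bound _ _ hA Finset.card_add_le (Finset.card_pos.2 (hne.add hne))
  have hcs : ∑ l ∈ Λ, ((fline (A - A) l).card : ℝ) * (fline (A + A) l).card ≤
      (∑ l ∈ Λ, ((fline (A - A) l).card : ℝ) ^ 2
        + ∑ l ∈ Λ, ((fline (A + A) l).card : ℝ) ^ 2) / 2 := by
    rw [← Finset.sum_add_distrib, Finset.sum_div]
    refine Finset.sum_le_sum fun l _ => ?_
    nlinarith [sq_nonneg (((fline (A - A) l).card : ℝ) - (fline (A + A) l).card)]
  set MX : ℝ := ((A - A + (A - A)).card : ℝ)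
  set MY : ℝ := ((A + A + (A + A)).card : ℝ)
  set lg := Real.log n
  have hMX0 : 0 ≤ MX := by positivity
  have hMY0 : 0 ≤ MY := by positivity
  have hQ2 : ((quads A).card : ℝ) ≤ 3 * n ^ 2 + 32 * MX ^ 2 * lg + 32 * MY ^ 2 * lg := by
    have t1 := mul_le_mul_of_nonneg_left gX (show 0 ≤ 16 * MX ^ 2 by positivity)
    have t2 := mul_le_mul_of_nonneg_left gY (show 0 ≤ 16 * MY ^ 2 by positivity)
    linarith
  have hn0 : 0 < n := by linarith
  have pX : MX ^ 2 * n ^ 2 ≤ S ^ 4 := by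
    calc MX ^ 2 * n ^ 2 = (MX * n) ^ 2 := by ring
      _ ≤ (S ^ 2) ^ 2 := by gcongr
      _ = S ^ 4 := by ring
  have pY : MY ^ 2 * n ^ 2 ≤ S ^ 4 := by
    calc MY ^ 2 * n ^ 2 = (MY * n) ^ 2 := by ring
      _ ≤ (S ^ 2) ^ 2 := by gcongr
      _ = S ^ 4 := by ring
  have pn : n ^ 4 ≤ S ^ 4 := by gcongr
  have hlg0 : 0 ≤ lg := by linarith
  have hQ3 : ((quads A).card : ℝ) * n ^ 2 ≤ 70 * (S ^ 4 * lg) := by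
    have s1 := mul_le_mul_of_nonneg_right hQ2 (sq_nonneg n)
    have s2 := mul_le_mul_of_nonneg_right pX hlg0
    have s3 := mul_le_mul_of_nonneg_right pY hlg0
    have s4 : S ^ 4 * (1 / 2) ≤ S ^ 4 * lg := mul_le_mul_of_nonneg_left hlog (by positivity)
    linarith
  have hL := quads_lower A
  set T : ℝ := ((A.image (fun a => a ^ 2) + A.image (fun a => a ^ 2)).card : ℝ)
  have hT0 : 0 ≤ T := by positivity
  have f1 := mul_le_mul_of_nonneg_right hL (sq_nonneg n)
  have f2 := mul_le_mul_of_nonneg_left hQ3 hT0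
  have f3 : n ^ 6 ≤ 70 * (T * S ^ 4 * lg) := by
    calc n ^ 6 = n ^ 4 * n ^ 2 := by ring
      _ ≤ T * (quads A).card * n ^ 2 := f1
      _ = T * ((quads A).card * n ^ 2) := by ring
      _ ≤ _ := f2
      _ = _ := by ring
  linarith
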